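/- Let p, q, r, a, b, c ∈ I be pairwise distinct IRIs and ?x, ?y, ?z pairwise distinct variables. The pattern ((?x, p, q) OPT (?y, q, a)) OPT ((?y, q, b) UNION (?z, r, c)) is not weakly monotonic (hence non-monotonic): there exist RDF graphs G₁ ⊆ G₂ such that ⟦P⟧_{G₁} ⊑ ⟦P⟧_{G₂} fails. -/

import Mathlib

namespace SPARQL

/-- Kinds of RDF constants: IRIs, blank nodes, literals. -/
inductive Kind : Type
  | iri | blank | lit
deriving DecidableEq

/-- The countably infinite set `U` of constants, partitioned into the three
infinite sets of IRIs `I` (kind `iri`), blank nodes `B` (kind `blank`) and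
literals `L` (kind `lit`). -/
abbrev Const := Kind × ℕ

/-- The countably infinite set `V` of variables (disjoint from `U`). -/
abbrev Var := ℕ

/-- A mapping: a partial function from variables to constants with finite domain. -/
structure Mapping where
  toFun : Var → Option Const
  finite : {x : Var | toFun x ≠ none}.Finite

/-- The domain of a mapping. -/
def Mapping.dom (μ : Mapping) : Set Var := {x | μ.toFun x ≠ none}

/-- Two mappings are compatible if they agree on the intersection of their domains. -/
def Compatible (μ₁ μ₂ : Mapping) : Prop :=
  ∀ x ∈ μ₁.dom ∩ μ₂.dom, μ₁.toFun x = μ₂.toFun x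

/-- Union of two mappings (preferring the first one where both are defined). -/
def Mapping.union (μ₁ μ₂ : Mapping) : Mapping where
  toFun := fun x => match μ₁.toFun x with
    | some u => some u
    | none => μ₂.toFun x
  finite := by
    apply (μ₁.finite.union μ₂.finite).subset
    intro x hx
    simp only [Set.mem_setOf_eq] at hx
    simp only [Set.mem_union, Set.mem_setOf_eq]
    by_cases h1 : μ₁.toFun x = none
    · right; intro h2; apply hx; simp [h1, h2]
    · left; exact h1

/-- A term: either a constant or a variable. -/
inductive Term : Type
  | const : Const → Term
  | var : Var → Term

/-- A triple pattern. -/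
abbrev TriplePat := Term × Term × Term

/-- An RDF graph: a finite set of triples of constants. -/
abbrev Graph := Finset (Const × Const × Const)

/-- Variables of a term. -/
def Term.vars : Term → Set Var
  | .const _ => ∅
  | .var x => {x}

/-- Variables of a triple pattern. -/
def tripleVars (t : TriplePat) : Set Var := t.1.vars ∪ t.2.1.vars ∪ t.2.2.vars

/-- Apply a mapping to a term. -/
def Term.app (μ : Mapping) : Term → Option Const
  | .const c => some c
  | .var x => μ.toFun x

/-- Three truth values: true, false, error. -/
inductive TV : Type
  | t | f | e
deriving DecidableEq

/-- Kleene negation. -/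
def TV.neg : TV → TV
  | .t => .f
  | .f => .t
  | .e => .e

/-- Kleene conjunction. -/
def TV.and : TV → TV → TV
  | .f, _ => .f
  | _, .f => .f
  | .t, .t => .t
  | _, _ => .e

/-- Kleene disjunction. -/
def TV.or : TV → TV → TV
  | .t, _ => .t
  | _, .t => .t
  | .f, .f => .f
  | _, _ => .e

/-- Constraints: Boolean combinations of the atomic constraints
`bound(?x)`, `?x = c`, `?x = ?y`, `isIRI(?x)`, `isBlank(?x)`, `isLiteral(?x)`. -/
inductive Constraint : Type
  | bound : Var → Constraint
  | eqC : Var → Const → Constraint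
  | eqV : Var → Var → Constraint
  | isIRI : Var → Constraint
  | isBlank : Var → Constraint
  | isLiteral : Var → Constraint
  | and : Constraint → Constraint → Constraint
  | or : Constraint → Constraint → Constraint
  | not : Constraint → Constraint

/-- Three-valued evaluation of a constraint on a mapping. -/
def Constraint.eval (μ : Mapping) : Constraint → TV
  | .bound x => match μ.toFun x with
      | some _ => .t
      | none => .f
  | .eqC x c => match μ.toFun x with
      | some u => if u = c then .t else .f
      | none => .e
  | .eqV x y => match μ.toFun x, μ.toFun y with
      | some u, some v => if u = v then .t else .f
      | _, _ => .e
  | .isIRI x => match μ.toFun x with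
      | some u => if u.1 = Kind.iri then .t else .f
      | none => .e
  | .isBlank x => match μ.toFun x with
      | some u => if u.1 = Kind.blank then .t else .f
      | none => .e
  | .isLiteral x => match μ.toFun x with
      | some u => if u.1 = Kind.lit then .t else .f
      | none => .e
  | .and C D => (C.eval μ).and (D.eval μ)
  | .or C D => (C.eval μ).or (D.eval μ)
  | .not C => (C.eval μ).neg

/-- SPARQL graph patterns. -/
inductive Pattern : Type
  | triple : TriplePat → Pattern
  | and : Pattern → Pattern → Pattern
  | union : Pattern → Pattern → Pattern
  | opt : Pattern → Pattern → Pattern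
  | filter : Pattern → Constraint → Pattern

/-- `μ(t) ∈ G` for a triple pattern `t`. -/
def tripleMatch (μ : Mapping) (t : TriplePat) (G : Graph) : Prop :=
  ∃ s p o : Const, t.1.app μ = some s ∧ t.2.1.app μ = some p ∧ t.2.2.app μ = some o ∧
    (s, p, o) ∈ G

/-- Evaluation of a pattern on an RDF graph: a set of mappings. -/
def Pattern.eval (G : Graph) : Pattern → Set Mapping
  | .triple t => {μ | μ.dom = tripleVars t ∧ tripleMatch μ t G}
  | .and P₁ P₂ =>
      {μ | ∃ μ₁ ∈ P₁.eval G, ∃ μ₂ ∈ P₂.eval G, Compatible μ₁ μ₂ ∧ μ = μ₁.union μ₂}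
  | .union P₁ P₂ => P₁.eval G ∪ P₂.eval G
  | .opt P₁ P₂ =>
      {μ | ∃ μ₁ ∈ P₁.eval G, ∃ μ₂ ∈ P₂.eval G, Compatible μ₁ μ₂ ∧ μ = μ₁.union μ₂} ∪
      {μ₁ ∈ P₁.eval G | ∀ μ₂ ∈ P₂.eval G, ¬ Compatible μ₁ μ₂}
  | .filter P C => {μ ∈ P.eval G | C.eval μ = TV.t}

/-- A pattern is monotonic if enlarging the graph enlarges the answer set. -/
def Monotonic (P : Pattern) : Prop :=
  ∀ G₁ G₂ : Graph, G₁ ⊆ G₂ → P.eval G₁ ⊆ P.eval G₂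

/-- Subsumption of mappings: `μ₁ ⊑ μ₂`. -/
def Mapping.Sub (μ₁ μ₂ : Mapping) : Prop :=
  μ₁.dom ⊆ μ₂.dom ∧ ∀ x ∈ μ₁.dom, μ₁.toFun x = μ₂.toFun x

/-- Subsumption of sets of mappings: `Ω₁ ⊑ Ω₂`. -/
def SetSub (Ω₁ Ω₂ : Set Mapping) : Prop :=
  ∀ μ₁ ∈ Ω₁, ∃ μ₂ ∈ Ω₂, μ₁.Sub μ₂

/-- A pattern is weakly monotonic if enlarging the graph subsumes the old answers. -/
def WeaklyMonotonic (P : Pattern) : Prop :=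
  ∀ G₁ G₂ : Graph, G₁ ⊆ G₂ → SetSub (P.eval G₁) (P.eval G₂)

/-- Variables occurring in the triple patterns of a pattern. -/
def Pattern.vars : Pattern → Set Var
  | .triple t => tripleVars t
  | .and P Q => P.vars ∪ Q.vars
  | .union P Q => P.vars ∪ Q.vars
  | .opt P Q => P.vars ∪ Q.vars
  | .filter P _ => P.vars


/-- The mapping with domain `{x}` sending `x` to `u`. -/
def single (x : Var) (u : Const) : Mapping where
  toFun := fun v => if v = x then some u else none
  finite := (Set.finite_singleton x).subset (by intro v hv; by_contra h; simp_all)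

theorem single_dom (x : Var) (u : Const) : (single x u).dom = {x} := by
  ext v; simp [single, Mapping.dom]

theorem single_mem (G : Graph) (x : Var) (u p q : Const) (h : (u, p, q) ∈ G) :
    single x u ∈ (Pattern.triple (Term.var x, Term.const p, Term.const q)).eval G := by
  refine ⟨?_, u, p, q, ?_, rfl, rfl, h⟩
  · rw [single_dom]; simp [tripleVars, Term.vars]
  · simp [Term.app, single]

theorem mem_triple (G : Graph) (x : Var) (p q : Const) (μ : Mapping)
    (h : μ ∈ (Pattern.triple (Term.var x, Term.const p, Term.const q)).eval G) :
    μ.dom = {x} ∧ ∃ u, μ.toFun x = some u ∧ (u, p, q) ∈ G := by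
  obtain ⟨h1, u, p', q', h2, h3, h4, h5⟩ := h
  refine ⟨by rw [h1]; simp [tripleVars, Term.vars], u, h2, ?_⟩
  simp only [Term.app, Option.some.injEq] at h3 h4
  subst h3; subst h4; exact h5

theorem compat_of_ne {x y : Var} (hxy : x ≠ y) {μ ν : Mapping}
    (h1 : μ.dom = {x}) (h2 : ν.dom = {y}) : Compatible μ ν := by
  intro v hv
  rw [h1, h2] at hv
  exact absurd (hv.1.symm.trans hv.2) hxy

theorem union_some {μ ν : Mapping} {v : Var} {u : Const} (h : μ.toFun v = some u) :
    (μ.union ν).toFun v = some u := by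
  simp [Mapping.union, h]

theorem union_none {μ ν : Mapping} {v : Var} (h : μ.toFun v = none) :
    (μ.union ν).toFun v = ν.toFun v := by
  simp [Mapping.union, h]

theorem none_of_dom {μ : Mapping} {x y : Var} (hxy : x ≠ y) (h : μ.dom = {x}) :
    μ.toFun y = none := by
  by_contra hn
  have : y ∈ μ.dom := hn
  rw [h] at this
  exact hxy this.symm

/-- for pairwise distinct IRIs `p, q, r, a, b, c` and pairwise
distinct variables `?x, ?y, ?z`, the pattern
`((?x, p, q) OPT (?y, q, a)) OPT ((?y, q, b) UNION (?z, r, c))`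
is not weakly monotonic. -/
theorem nested_opt_union_not_weaklyMonotonic
    (p q r a b c : Const) (hp : p.1 = Kind.iri) (hq : q.1 = Kind.iri)
    (hr : r.1 = Kind.iri) (ha : a.1 = Kind.iri) (hb : b.1 = Kind.iri)
    (hc : c.1 = Kind.iri) (hdist : List.Pairwise (· ≠ ·) [p, q, r, a, b, c])
    (x y z : Var) (hxy : x ≠ y) (hxz : x ≠ z) (hyz : y ≠ z) :
    ∃ G₁ G₂ : Graph, G₁ ⊆ G₂ ∧
      ¬ SetSub
        ((Pattern.opt
          (Pattern.opt
            (Pattern.triple (Term.var x, Term.const p, Term.const q))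
            (Pattern.triple (Term.var y, Term.const q, Term.const a)))
          (Pattern.union
            (Pattern.triple (Term.var y, Term.const q, Term.const b))
            (Pattern.triple (Term.var z, Term.const r, Term.const c)))).eval G₁)
        ((Pattern.opt
          (Pattern.opt
            (Pattern.triple (Term.var x, Term.const p, Term.const q))
            (Pattern.triple (Term.var y, Term.const q, Term.const a)))
          (Pattern.union
            (Pattern.triple (Term.var y, Term.const q, Term.const b))
            (Pattern.triple (Term.var z, Term.const r, Term.const c)))).eval G₂) := by
  simp only [List.pairwise_cons, List.mem_cons, List.not_mem_nil, or_false] at hdist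
  have hpq : p ≠ q := hdist.1 q (by simp)
  have hab : a ≠ b := hdist.2.2.2.1 b (by simp)
  refine ⟨{(a, p, q), (b, q, b)}, {(a, p, q), (b, q, b), (a, q, a)}, ?_, ?_⟩
  · intro t ht
    simp only [Finset.mem_insert, Finset.mem_singleton] at ht ⊢
    tauto
  intro hS
  have hyn : (single x a).toFun y = none := none_of_dom hxy (single_dom x a)
  obtain ⟨μ, hμ, hsub⟩ := hS ((single x a).union (single y b)) (by
    refine Or.inl ⟨single x a, ?_, single y b, ?_, ?_, rfl⟩
    · refine Or.inr ⟨single_mem _ _ _ _ _ (by simp), ?_⟩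
      intro ν hν
      obtain ⟨-, u, -, hu⟩ := mem_triple _ _ _ _ _ hν
      simp only [Finset.mem_insert, Finset.mem_singleton, Prod.mk.injEq] at hu
      rcases hu with ⟨_, h, _⟩ | ⟨_, _, h⟩
      · exact absurd h.symm hpq
      · exact absurd h hab
    · exact Or.inl (single_mem _ _ _ _ _ (by simp))
    · exact compat_of_ne hxy (single_dom _ _) (single_dom _ _))
  have hy : ((single x a).union (single y b)).toFun y = some b := by
    rw [union_none hyn]; simp [single]
  have hμb : μ.toFun y = some b := by
    rw [← hsub.2 y (by simp [Mapping.dom, hy]), hy]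
  have key : ∀ ν ∈ (Pattern.opt
      (Pattern.triple (Term.var x, Term.const p, Term.const q))
      (Pattern.triple (Term.var y, Term.const q, Term.const a))).eval
        {(a, p, q), (b, q, b), (a, q, a)}, ν.toFun y = some a := by
    intro ν hν
    rcases hν with ⟨ν₁, h₁, ν₂, h₂, -, rfl⟩ | ⟨h₁, h₂⟩
    · rw [union_none (none_of_dom hxy (mem_triple _ _ _ _ _ h₁).1)]
      obtain ⟨-, u, hu, hG⟩ := mem_triple _ _ _ _ _ h₂
      simp only [Finset.mem_insert, Finset.mem_singleton, Prod.mk.injEq] at hG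
      rcases hG with ⟨_, h, _⟩ | ⟨_, _, h⟩ | ⟨h, _, _⟩
      · exact absurd h.symm hpq
      · exact absurd h hab
      · rw [hu, h]
    · exact absurd (compat_of_ne hxy (mem_triple _ _ _ _ _ h₁).1 (single_dom y a))
        (h₂ _ (single_mem _ _ _ _ _ (by simp)))
  have hμa : μ.toFun y = some a := by
    rcases hμ with ⟨ν₁, h₁, ν₂, -, -, rfl⟩ | ⟨h₁, -⟩
    · exact union_some (key _ h₁)
    · exact key _ h₁
  rw [hμa] at hμb
  exact hab (Option.some.inj hμb)

end SPARQL
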